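/- arXiv:2306.03151 — 2 statements merged into one kernel-verified Lean document; each statement's English description precedes it below -/
import Mathlib

section
/- (Claim 5, first part: asymptotic variance of k-DISCount) Let F̂_n(S) denote the k-DISCount estimator based on n i.i.d. samples from ḡ_Ω, and suppose 0 < p(S) < 1. Then lim_{n → ∞} n · Var(F̂_n(S)) = G(S)² · σ²(S)/p(S). -/
open Finset Filter

noncomputable section

variable {Ω : Type*} [Fintype Ω] [DecidableEq Ω]

/-- Expectation of `X : (Fin n → Ω) → ℝ` under `n` i.i.d. samples drawn from the
pmf `q` on the finite type `Ω` (the `n`-fold product measure). -/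
noncomputable def iidExp (n : ℕ) (q : Ω → ℝ) (X : (Fin n → Ω) → ℝ) : ℝ :=
  ∑ v : Fin n → Ω, (∏ i, q (v i)) * X v

/-- Probability of the event `P` under `n` i.i.d. samples drawn from the pmf `q`. -/
noncomputable def iidPr (n : ℕ) (q : Ω → ℝ) (P : (Fin n → Ω) → Prop) [DecidablePred P] : ℝ :=
  iidExp n q fun v => if P v then 1 else 0

/-- Variance of `X` under `n` i.i.d. samples drawn from the pmf `q`. -/
noncomputable def iidVar (n : ℕ) (q : Ω → ℝ) (X : (Fin n → Ω) → ℝ) : ℝ :=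
  iidExp n q fun v => (X v - iidExp n q X) ^ 2

/-- `n(S)`: the number of the samples `v 0, …, v (n-1)` that land in `S`. -/
def nIn (S : Finset Ω) {n : ℕ} (v : Fin n → Ω) : ℕ :=
  (Finset.univ.filter fun i => v i ∈ S).card

/-- The `k`-DISCount estimator `F̂(S)`: equal to
`G(S) · (1/n(S)) · ∑_{i : sᵢ ∈ S} f(sᵢ)/g(sᵢ)` if `n(S) > 0`, and `0` otherwise. -/
noncomputable def kdis (S : Finset Ω) (f g : Ω → ℝ) {n : ℕ} (v : Fin n → Ω) : ℝ :=
  if 0 < nIn S v then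
    (∑ s ∈ S, g s) *
      ((nIn S v : ℝ)⁻¹ * ∑ i ∈ Finset.univ.filter (fun i => v i ∈ S), f (v i) / g (v i))
  else 0

set_option linter.unusedSectionVars false

lemma iidExp_add (n : ℕ) (q : Ω → ℝ) (X Y : (Fin n → Ω) → ℝ) :
    iidExp n q (fun v => X v + Y v) = iidExp n q X + iidExp n q Y := by
  simp only [iidExp, mul_add, sum_add_distrib]

lemma iidExp_const_mul (n : ℕ) (q : Ω → ℝ) (c : ℝ) (X : (Fin n → Ω) → ℝ) :
    iidExp n q (fun v => c * X v) = c * iidExp n q X := by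
  simp only [iidExp, mul_sum]
  exact sum_congr rfl fun v _ => by ring

lemma iidExp_sum {ι : Type*} (s : Finset ι) (n : ℕ) (q : Ω → ℝ) (X : ι → (Fin n → Ω) → ℝ) :
    iidExp n q (fun v => ∑ i ∈ s, X i v) = ∑ i ∈ s, iidExp n q (X i) := by
  simp only [iidExp, mul_sum]
  exact sum_comm

lemma iidExp_mono (n : ℕ) {q : Ω → ℝ} (hq : ∀ s, 0 ≤ q s) {X Y : (Fin n → Ω) → ℝ}
    (h : ∀ v, X v ≤ Y v) : iidExp n q X ≤ iidExp n q Y :=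
  sum_le_sum fun v _ => mul_le_mul_of_nonneg_left (h v) (prod_nonneg fun _ _ => hq _)

/-- Conditioning on the value of the `i`-th sample. -/
lemma iidExp_succ (m : ℕ) (q : Ω → ℝ) (i : Fin (m + 1)) (X : (Fin (m + 1) → Ω) → ℝ) :
    iidExp (m + 1) q X =
      ∑ x, q x * iidExp m q (fun w => X (i.insertNth (α := fun _ => Ω) x w)) := by
  simp only [iidExp]
  rw [← (Fin.insertNthEquiv (fun _ => Ω) i).sum_comp, Fintype.sum_prod_type]
  simp [Fin.insertNthEquiv, Fin.prod_univ_succAbove _ i, mul_sum, mul_assoc]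

lemma iidExp_const (n : ℕ) {q : Ω → ℝ} (hq : ∑ s, q s = 1) (c : ℝ) :
    iidExp n q (fun _ => c) = c := by
  induction n with
  | zero => simp [iidExp]
  | succ m ih => rw [iidExp_succ m q 0]; simp [ih, ← sum_mul, hq]

lemma nIn_eq_sum (S : Finset Ω) {n : ℕ} (v : Fin n → Ω) :
    nIn S v = ∑ i, if v i ∈ S then 1 else 0 := by
  simp [nIn]

lemma nIn_insertNth (S : Finset Ω) {m : ℕ} (i : Fin (m + 1)) (x : Ω) (w : Fin m → Ω) :
    nIn S (i.insertNth (α := fun _ => Ω) x w) = (if x ∈ S then 1 else 0) + nIn S w := by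
  simp [nIn_eq_sum, Fin.sum_univ_succAbove _ i]

lemma iidExp_nIn_eq_zero (n : ℕ) {q : Ω → ℝ} (hq : ∑ s, q s = 1) (S : Finset Ω) :
    iidExp n q (fun v => if nIn S v = 0 then 1 else 0) = (1 - ∑ s ∈ S, q s) ^ n := by
  induction n with
  | zero => simp [iidExp, nIn]
  | succ m ih =>
    have hc : 1 - ∑ s ∈ S, q s = ∑ s ∈ Sᶜ, q s := by
      rw [← hq, ← sum_compl_add_sum S q, add_sub_cancel_right]
    rw [iidExp_succ m q 0, pow_succ', ← ih, hc, ← sum_compl_add_sum S, sum_mul]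
    have h0 : iidExp m q (fun _ => 0) = 0 := by simp [iidExp]
    have h1 : ∑ x ∈ S, q x * iidExp m q (fun w =>
        if nIn S (Fin.insertNth (α := fun _ => Ω) 0 x w) = 0 then 1 else 0) = 0 :=
      sum_eq_zero fun x hx => by simp only [nIn_insertNth]; simp [hx, h0]
    rw [h1, add_zero]
    refine sum_congr rfl fun x hx => ?_
    rw [mem_compl] at hx
    simp only [nIn_insertNth]
    simp [hx]

/-- For `a` supported on `S`, conditioning on each sample in turn evaluates the expectation of
the sample sum of `a` times a function of that sum and of the number of samples in `S`. -/
lemma iidExp_sum_mul (m : ℕ) (q : Ω → ℝ) (S : Finset Ω) (a : Ω → ℝ) (ha : ∀ x, x ∉ S → a x = 0)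
    (φ : ℝ → ℕ → ℝ) :
    iidExp (m + 1) q (fun v => (∑ i, a (v i)) * φ (∑ j, a (v j)) (nIn S v)) =
      (m + 1) * ∑ x, q x * a x *
        iidExp m q (fun w => φ (a x + ∑ j, a (w j)) (nIn S w + 1)) := by
  simp only [sum_mul]
  rw [iidExp_sum]
  have key : ∀ i : Fin (m + 1),
      iidExp (m + 1) q (fun v => a (v i) * φ (∑ j, a (v j)) (nIn S v)) =
        ∑ x, q x * a x * iidExp m q (fun w => φ (a x + ∑ j, a (w j)) (nIn S w + 1)) := by
    intro i
    rw [iidExp_succ m q i]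
    refine sum_congr rfl fun x _ => ?_
    simp only [nIn_insertNth, Fin.sum_univ_succAbove _ i, Fin.insertNth_apply_same,
      Fin.insertNth_apply_succAbove]
    rw [iidExp_const_mul, mul_assoc]
    by_cases hx : x ∈ S
    · simp only [hx, if_true, add_comm 1]
    · simp [ha x hx]
  simp [key]

/-- Size-biasing identity for the number of samples in `S`. -/
lemma iidExp_nIn_mul (m : ℕ) (q : Ω → ℝ) (S : Finset Ω) (φ : ℕ → ℝ) :
    iidExp (m + 1) q (fun v => (nIn S v : ℝ) * φ (nIn S v)) =
      (m + 1) * (∑ s ∈ S, q s) * iidExp m q (fun w => φ (nIn S w + 1)) := by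
  have h := iidExp_sum_mul m q S (fun x => if x ∈ S then 1 else 0) (by simp +contextual)
    (fun _ k => φ k)
  have hN : ∀ v : Fin (m + 1) → Ω, (nIn S v : ℝ) = ∑ i, if v i ∈ S then (1 : ℝ) else 0 := by
    intro v; simp [nIn_eq_sum]
  simp only [hN]
  rw [h, ← sum_mul, ← mul_assoc]
  simp

lemma iidExp_inv_nIn_add_one (m : ℕ) {q : Ω → ℝ} (hq : ∑ s, q s = 1) (S : Finset Ω)
    (hp : 0 < ∑ s ∈ S, q s) :
    iidExp m q (fun w => ((nIn S w : ℝ) + 1)⁻¹) =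
      (1 - (1 - ∑ s ∈ S, q s) ^ (m + 1)) / ((m + 1) * ∑ s ∈ S, q s) := by
  have h := iidExp_nIn_mul m q S (fun k => (k : ℝ)⁻¹)
  have h2 : iidExp (m + 1) q (fun v => (nIn S v : ℝ) * (nIn S v : ℝ)⁻¹) =
      1 - (1 - ∑ s ∈ S, q s) ^ (m + 1) := by
    have e : ∀ v : Fin (m + 1) → Ω, (nIn S v : ℝ) * (nIn S v : ℝ)⁻¹ =
        1 + (-1) * (if nIn S v = 0 then 1 else 0) := by
      intro v
      by_cases h0 : nIn S v = 0 <;> simp [h0]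
    simp only [e]
    rw [iidExp_add, iidExp_const_mul, iidExp_const _ hq, iidExp_nIn_eq_zero _ hq]
    ring
  simp only [Nat.cast_add, Nat.cast_one] at h
  rw [eq_div_iff (by positivity), ← h2, h]
  ring

lemma iidExp_inv_nIn_add_one_mul_le (m : ℕ) {q : Ω → ℝ} (hq0 : ∀ s, 0 ≤ q s)
    (hq : ∑ s, q s = 1) (S : Finset Ω) (hp : 0 < ∑ s ∈ S, q s) :
    iidExp m q (fun w => (((nIn S w : ℝ) + 1) * ((nIn S w : ℝ) + 2))⁻¹) ≤
      1 / ((m + 1) * (m + 2) * (∑ s ∈ S, q s) ^ 2) := by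
  have h := iidExp_nIn_mul m q S (fun k => ((k : ℝ) * (k + 1))⁻¹)
  have h2 : iidExp (m + 1) q (fun v => (nIn S v : ℝ) * ((nIn S v : ℝ) * (nIn S v + 1))⁻¹) ≤
      iidExp (m + 1) q (fun v => ((nIn S v : ℝ) + 1)⁻¹) := by
    refine iidExp_mono _ hq0 fun v => ?_
    rcases eq_or_ne (nIn S v : ℝ) 0 with h0 | h0
    · simp [h0]
    · rw [mul_inv, mul_inv_cancel_left₀ h0]
  rw [h, iidExp_inv_nIn_add_one _ hq S hp] at h2
  have hle : ∑ s ∈ S, q s ≤ 1 := hq ▸ sum_le_univ_sum_of_nonneg hq0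
  have h3 : (1 - (1 - ∑ s ∈ S, q s) ^ (m + 1 + 1)) / (((m + 1 : ℕ) + 1 : ℝ) * ∑ s ∈ S, q s) ≤
      1 / ((m + 2) * ∑ s ∈ S, q s) := by
    push_cast
    rw [add_assoc (m : ℝ), one_add_one_eq_two]
    gcongr
    exact sub_le_self _ (pow_nonneg (sub_nonneg.2 hle) _)
  have h4 := h2.trans h3
  have e : ∀ k : ℕ, (((k + 1 : ℕ) : ℝ) * ((k + 1 : ℕ) + 1))⁻¹ = (((k : ℝ) + 1) * (k + 2))⁻¹ := by
    intro k; push_cast; ring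
  simp only [e] at h4
  rw [le_div_iff₀ (by positivity)] at h4 ⊢
  linarith

/-- The expected reciprocal of the number of samples in `S` is asymptotically `1 / (n p(S))`. -/
lemma tendsto_mul_iidExp_inv_nIn {q : Ω → ℝ} (hq0 : ∀ s, 0 ≤ q s) (hq : ∑ s, q s = 1)
    (S : Finset Ω) (hp : 0 < ∑ s ∈ S, q s) :
    Tendsto (fun n : ℕ => (n : ℝ) * iidExp n q (fun v => (nIn S v : ℝ)⁻¹)) atTop
      (nhds (1 / ∑ s ∈ S, q s)) := by
  have hle : ∑ s ∈ S, q s ≤ 1 := hq ▸ sum_le_univ_sum_of_nonneg hq0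
  set p := ∑ s ∈ S, q s with hpdef
  have hr : Tendsto (fun n : ℕ => (n : ℝ) * (1 - p) ^ n) atTop (nhds 0) :=
    tendsto_self_mul_const_pow_of_lt_one (by linarith) (by linarith)
  have hr' : Tendsto (fun n : ℕ => (1 - p) ^ (n + 1)) atTop (nhds 0) :=
    (tendsto_pow_atTop_nhds_zero_of_lt_one (by linarith) (by linarith)).comp (tendsto_add_atTop_nat 1)
  have hn : Tendsto (fun n : ℕ => (n : ℝ) / (n + 1)) atTop (nhds 1) :=
    tendsto_natCast_div_add_atTop 1
  have hmid : Tendsto (fun n : ℕ => (n : ℝ) * iidExp n q (fun v => ((nIn S v : ℝ) + 1)⁻¹)) atTop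
      (nhds (1 / p)) := by
    have := hn.mul ((hr'.const_sub 1).div_const p)
    rw [sub_zero, one_mul] at this
    refine this.congr fun n => ?_
    rw [iidExp_inv_nIn_add_one n hq S hp, ← hpdef]
    field_simp
  have herr : Tendsto (fun n : ℕ => 3 / p ^ 2 * (1 / ((n : ℝ) + 1))) atTop (nhds 0) := by
    simpa only [mul_zero] using
      (tendsto_one_div_add_atTop_nhds_zero_nat (𝕜 := ℝ)).const_mul (3 / p ^ 2)
  have hlo := hmid.sub hr
  have hhi := hmid.add herr
  rw [sub_zero] at hlo
  rw [add_zero] at hhi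
  refine tendsto_of_tendsto_of_tendsto_of_le_of_le hlo hhi (fun n => ?_) (fun n => ?_)
  · have h : iidExp n q (fun v => ((nIn S v : ℝ) + 1)⁻¹) ≤ iidExp n q (fun v =>
        (nIn S v : ℝ)⁻¹ + if nIn S v = 0 then 1 else 0) := by
      refine iidExp_mono n hq0 fun v => ?_
      rcases Nat.eq_zero_or_pos (nIn S v) with h0 | h0
      · simp [h0]
      · have : (0 : ℝ) < nIn S v := by exact_mod_cast h0
        rw [if_neg h0.ne', add_zero]
        gcongr
        linarith
    rw [iidExp_add, iidExp_nIn_eq_zero n hq] at h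
    have := mul_le_mul_of_nonneg_left h (Nat.cast_nonneg (α := ℝ) n)
    simp only
    linarith
  · have h : iidExp n q (fun v => (nIn S v : ℝ)⁻¹) ≤ iidExp n q (fun v =>
        ((nIn S v : ℝ) + 1)⁻¹ + 3 * (((nIn S v : ℝ) + 1) * ((nIn S v : ℝ) + 2))⁻¹) := by
      refine iidExp_mono n hq0 fun v => ?_
      rcases Nat.eq_zero_or_pos (nIn S v) with h0 | h0
      · simp [h0]; norm_num
      · have : (1 : ℝ) ≤ nIn S v := by exact_mod_cast h0
        generalize (nIn S v : ℝ) = k at this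
        have e : (k + 1)⁻¹ + 3 * ((k + 1) * (k + 2))⁻¹ - k⁻¹ =
            (2 * k - 2) / (k * (k + 1) * (k + 2)) := by
          field_simp
          ring
        have : 0 ≤ (2 * k - 2) / (k * (k + 1) * (k + 2)) :=
          div_nonneg (by linarith) (by positivity)
        linarith
    rw [iidExp_add, iidExp_const_mul] at h
    have h2 := iidExp_inv_nIn_add_one_mul_le n hq0 hq S hp
    have h3 : (n : ℝ) * (3 * (1 / ((n + 1) * (n + 2) * p ^ 2))) ≤
        3 / p ^ 2 * (1 / ((n : ℝ) + 1)) := by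
      have e : (n : ℝ) * (3 * (1 / ((n + 1) * (n + 2) * p ^ 2))) =
          3 / p ^ 2 * (1 / ((n : ℝ) + 1)) * (n / (n + 2)) := by field_simp
      rw [e]
      refine mul_le_of_le_one_right (by positivity) ?_
      rw [div_le_one (by positivity)]
      linarith
    calc (n : ℝ) * iidExp n q (fun v => (nIn S v : ℝ)⁻¹)
        ≤ n * (iidExp n q (fun v => ((nIn S v : ℝ) + 1)⁻¹) +
            3 * (1 / ((n + 1) * (n + 2) * p ^ 2))) := by gcongr; linarith
      _ ≤ _ := by rw [mul_add]; linarith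

lemma iidVar_eq_sub_sq (n : ℕ) {q : Ω → ℝ} (hq : ∑ s, q s = 1) (X : (Fin n → Ω) → ℝ) :
    iidVar n q X = iidExp n q (fun v => X v ^ 2) - iidExp n q X ^ 2 := by
  have e : ∀ v, (X v - iidExp n q X) ^ 2 =
      X v ^ 2 + ((-2 * iidExp n q X) * X v + iidExp n q X ^ 2) := fun v => by ring
  simp only [iidVar, e]
  rw [iidExp_add, iidExp_add, iidExp_const_mul, iidExp_const n hq]
  ring

/-- Decomposition of the estimator around the ratio `μ`, with `0⁻¹ = 0`. -/
lemma kdis_eq (S : Finset Ω) (f g : Ω → ℝ) (μ : ℝ) {n : ℕ} (v : Fin n → Ω) :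
    kdis S f g v = (∑ s ∈ S, g s) * (μ * (1 - if nIn S v = 0 then 1 else 0) +
      (∑ i, if v i ∈ S then f (v i) / g (v i) - μ else 0) * (nIn S v : ℝ)⁻¹) := by
  rcases Nat.eq_zero_or_pos (nIn S v) with h0 | h0
  · simp [kdis, h0]
  · have hN : (nIn S v : ℝ) ≠ 0 := by exact_mod_cast h0.ne'
    have hsum : (∑ i, if v i ∈ S then f (v i) / g (v i) - μ else 0) =
        ∑ i ∈ univ.filter (fun i => v i ∈ S), f (v i) / g (v i) - nIn S v * μ := by
      rw [← sum_filter, sum_sub_distrib, sum_const, nsmul_eq_mul, nIn]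
    rw [kdis, if_pos h0, if_neg h0.ne', hsum]
    field_simp
    ring

/-- Exact variance of the `k`-DISCount estimator, in terms of the expected reciprocal of `n(S)`. -/
lemma iidVar_kdis_succ (m : ℕ) {q : Ω → ℝ} (hq : ∑ s, q s = 1) (S : Finset Ω) (f g : Ω → ℝ)
    (μ σ2 : ℝ) (hμ : ∑ s ∈ S, q s * (f s / g s - μ) = 0)
    (hσ2 : ∑ s ∈ S, q s * (f s / g s - μ) ^ 2 = (∑ s ∈ S, q s) * σ2) :
    iidVar (m + 1) q (fun v => kdis S f g v) = (∑ s ∈ S, g s) ^ 2 *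
      (μ ^ 2 * ((1 - ∑ s ∈ S, q s) ^ (m + 1) * (1 - (1 - ∑ s ∈ S, q s) ^ (m + 1))) +
        σ2 * iidExp (m + 1) q (fun v => (nIn S v : ℝ)⁻¹)) := by
  set a : Ω → ℝ := fun x => if x ∈ S then f x / g x - μ else 0 with ha
  have haS : ∀ x, x ∉ S → a x = 0 := fun x hx => by simp [ha, hx]
  have ha1 : ∑ x, q x * a x = 0 := by simpa [ha] using hμ
  have ha2 : ∑ x, q x * a x * a x = (∑ s ∈ S, q s) * σ2 := by
    rw [← hσ2]
    simp [ha, pow_two, mul_assoc]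
  set Z : (Fin (m + 1) → Ω) → ℝ := fun v => if nIn S v = 0 then 1 else 0 with hZ
  have hEZ : iidExp (m + 1) q Z = (1 - ∑ s ∈ S, q s) ^ (m + 1) := iidExp_nIn_eq_zero _ hq S
  have hT : iidExp (m + 1) q (fun v => (∑ i, a (v i)) * (nIn S v : ℝ)⁻¹) = 0 := by
    rw [iidExp_sum_mul m q S a haS (fun _ k => (k : ℝ)⁻¹), ← sum_mul, ha1]
    ring
  have hT2 : iidExp (m + 1) q
      (fun v => (∑ i, a (v i)) * ((∑ i, a (v i)) * ((nIn S v : ℝ) ^ 2)⁻¹)) =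
        σ2 * iidExp (m + 1) q (fun v => (nIn S v : ℝ)⁻¹) := by
    have hN : ∀ v : Fin (m + 1) → Ω,
        (nIn S v : ℝ)⁻¹ = (nIn S v : ℝ) * ((nIn S v : ℝ) ^ 2)⁻¹ := by
      intro v
      rcases eq_or_ne (nIn S v : ℝ) 0 with h0 | h0
      · simp [h0]
      · field_simp
    simp only [hN]
    rw [iidExp_sum_mul m q S a haS (fun t k => t * ((k : ℝ) ^ 2)⁻¹),
      iidExp_nIn_mul m q S (fun k => ((k : ℝ) ^ 2)⁻¹)]
    simp only [add_mul, iidExp_add, iidExp_const_mul]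
    simp only [mul_add, sum_add_distrib, ← mul_assoc, ← sum_mul]
    rw [ha1, ha2]
    ring
  have hX : ∀ v : Fin (m + 1) → Ω, kdis S f g v = (∑ s ∈ S, g s) *
      ((μ + (-μ) * Z v) + (∑ i, a (v i)) * (nIn S v : ℝ)⁻¹) := by
    intro v
    rw [kdis_eq S f g μ v]
    ring
  have hX2 : ∀ v : Fin (m + 1) → Ω, kdis S f g v ^ 2 = (∑ s ∈ S, g s) ^ 2 *
      ((μ ^ 2 + (-μ ^ 2) * Z v) + ((2 * μ) * ((∑ i, a (v i)) * (nIn S v : ℝ)⁻¹) +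
        (∑ i, a (v i)) * ((∑ i, a (v i)) * ((nIn S v : ℝ) ^ 2)⁻¹))) := by
    intro v
    rw [hX v]
    by_cases h0 : nIn S v = 0
    · simp [hZ, h0]
    · simp only [hZ, h0, if_false]
      ring
  rw [iidVar_eq_sub_sq _ hq]
  simp only [hX2]
  simp only [hX]
  simp only [iidExp_const_mul, iidExp_add, iidExp_const _ hq, hEZ, hT, hT2]
  ring

/-- **Claim 5, first part: asymptotic variance of k-DISCount.**
Let `F̂ₙ(S)` denote the k-DISCount estimator based on `n` i.i.d. samples from
`ḡ_Ω`, and suppose `0 < p(S) < 1` where `p(S) = G(S)/G(Ω)`. Then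
`lim_{n → ∞} n · Var(F̂ₙ(S)) = G(S)² σ²(S)/p(S)`. -/
theorem kdiscount_asymptotic_variance
    (S : Finset Ω) (hS : S.Nonempty) (f g : Ω → ℝ)
    (hf : ∀ s, 0 ≤ f s) (hg : ∀ s, 0 < g s)
    (q : Ω → ℝ) (hq : q = fun s => g s / ∑ t, g t)
    (p : ℝ) (hp : p = (∑ s ∈ S, g s) / ∑ s, g s) (hp0 : 0 < p) (hp1 : p < 1)
    (σ2 : ℝ)
    (hσ2 : σ2 = ∑ s ∈ S, (g s / ∑ t ∈ S, g t) *
        (f s / g s - (∑ t ∈ S, f t) / ∑ t ∈ S, g t) ^ 2) :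
    Tendsto (fun n : ℕ => (n : ℝ) * iidVar n q (fun v => kdis S f g v)) atTop
      (nhds ((∑ s ∈ S, g s) ^ 2 * σ2 / p)) := by
  have hGS : 0 < ∑ s ∈ S, g s := sum_pos (fun s _ => hg s) hS
  have hGΩ : 0 < ∑ s, g s := hGS.trans_le (sum_le_univ_sum_of_nonneg fun s => (hg s).le)
  have hq0 : ∀ s, 0 ≤ q s := fun s => by rw [hq]; exact div_nonneg (hg s).le hGΩ.le
  have hq1 : ∑ s, q s = 1 := by rw [hq, ← sum_div, div_self hGΩ.ne']
  have hqS : ∑ s ∈ S, q s = p := by rw [hq, hp, ← sum_div]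
  set μ : ℝ := (∑ t ∈ S, f t) / ∑ t ∈ S, g t with hμdef
  have hμ : ∑ s ∈ S, q s * (f s / g s - μ) = 0 := by
    have e : ∀ s, q s * (f s / g s - μ) = (f s - g s * μ) / ∑ t, g t := fun s => by
      have := (hg s).ne'
      rw [hq]
      field_simp
    simp only [e]
    rw [← sum_div, sum_sub_distrib, ← sum_mul, hμdef, mul_div_cancel₀ _ hGS.ne', sub_self,
      zero_div]
  have hσ : ∑ s ∈ S, q s * (f s / g s - μ) ^ 2 = (∑ s ∈ S, q s) * σ2 := by
    rw [hqS, hσ2, hp, mul_sum]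
    refine sum_congr rfl fun s _ => ?_
    rw [hq, ← mul_assoc]
    congr 1
    field_simp
  have hr : Tendsto (fun n : ℕ => (n : ℝ) * (1 - p) ^ n) atTop (nhds 0) :=
    tendsto_self_mul_const_pow_of_lt_one (by linarith) (by linarith)
  have hr' : Tendsto (fun n : ℕ => (1 - p) ^ n) atTop (nhds 0) :=
    tendsto_pow_atTop_nhds_zero_of_lt_one (by linarith) (by linarith)
  have hinv := tendsto_mul_iidExp_inv_nIn hq0 hq1 S (hqS ▸ hp0)
  rw [hqS] at hinv
  have hlim := (((hr.mul (hr'.const_sub 1)).const_mul (μ ^ 2)).add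
    (hinv.const_mul σ2)).const_mul ((∑ s ∈ S, g s) ^ 2)
  have e : (∑ s ∈ S, g s) ^ 2 * (μ ^ 2 * (0 * (1 - 0)) + σ2 * (1 / p)) =
      (∑ s ∈ S, g s) ^ 2 * σ2 / p := by ring
  rw [e] at hlim
  refine hlim.congr' ?_
  filter_upwards [eventually_ge_atTop 1] with n hn
  obtain ⟨m, rfl⟩ := Nat.exists_eq_add_of_le' hn
  rw [iidVar_kdis_succ m hq1 S f g μ σ2 hμ hσ, hqS]
  ring
end
end

section
/- (Conditional unbiasedness of k-DISCount with control variates) Let h : Ω → ℝ be any function with H(T) = Σ_{s ∈ T} h(s). Let s_1, ..., s_n be i.i.d. from ḡ_Ω, n(S) = |{i : s_i ∈ S}|, and define F̂_cv(S) = G(S) · (1/n(S)) Σ_{i : s_i ∈ S} (f(s_i) − h(s_i))/g(s_i) + H(S) when n(S) > 0, and F̂_cv(S) = 0 when n(S) = 0. Then E[F̂_cv(S) | n(S) > 0] = F(S). -/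
open Finset Filter

noncomputable section

variable {Ω : Type*} [Fintype Ω] [DecidableEq Ω]

/-- The k-DISCount estimator with control variate `h`:
`F̂_cv(S) = G(S) · (1/n(S)) ∑_{i : sᵢ ∈ S} (f(sᵢ) − h(sᵢ))/g(sᵢ) + H(S)` when
`n(S) > 0`, and `0` when `n(S) = 0`. -/
noncomputable def kdisCV (S : Finset Ω) (f h g : Ω → ℝ) {n : ℕ} (v : Fin n → Ω) : ℝ :=
  if 0 < nIn S v then
    (∑ s ∈ S, g s) *
        ((nIn S v : ℝ)⁻¹ *
          ∑ i ∈ Finset.univ.filter (fun i => v i ∈ S), (f (v i) - h (v i)) / g (v i)) +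
      ∑ s ∈ S, h s
  else 0

/-- The number of samples in `S` after inserting one sample that lies in `S`. -/
lemma nIn_insertNth_of_mem {α : Type*} [DecidableEq α] {S : Finset α} {s : α} (hs : s ∈ S)
    {m : ℕ} (i : Fin (m + 1)) (w : Fin m → α) :
    nIn S (i.insertNth (α := fun _ => α) s w) = nIn S w + 1 := by
  simp only [nIn, Finset.card_filter, Fin.sum_univ_succAbove _ i, Fin.insertNth_apply_same,
    Fin.insertNth_apply_succAbove, if_pos hs]
  exact add_comm _ _

/-- If `φ` has zero `q`-mean on `S`, a single sample contributes zero to the expectation of the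
average of `φ` over the samples that land in `S`. -/
lemma iidExp_inv_nIn_mul_ite_eq_zero {S : Finset Ω} {q φ : Ω → ℝ} (hφ : ∑ s ∈ S, q s * φ s = 0)
    {n : ℕ} (i : Fin n) :
    iidExp n q (fun v => (nIn S v : ℝ)⁻¹ * if v i ∈ S then φ (v i) else 0) = 0 := by
  obtain _ | m := n
  · exact i.elim0
  rw [iidExp, ← (Fin.insertNthEquiv (fun _ => Ω) i).sum_comp, Fintype.sum_prod_type_right]
  refine Finset.sum_eq_zero fun w _ => ?_
  calc
    _ = ∑ s, (if s ∈ S then q s * φ s else 0) * ((∏ j, q (w j)) * ((nIn S w + 1 : ℕ) : ℝ)⁻¹) := by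
      refine Finset.sum_congr rfl fun s _ => ?_
      simp only [Fin.insertNthEquiv_apply, Fin.prod_univ_succAbove _ i,
        Fin.insertNth_apply_same, Fin.insertNth_apply_succAbove]
      split_ifs with hs
      · have hcount : nIn S (Fin.insertNthEquiv (fun _ => Ω) i (s, w)) = nIn S w + 1 :=
          nIn_insertNth_of_mem hs i w
        rw [hcount]
        ring
      · simp
    _ = 0 := by
      rw [← Finset.sum_mul, Finset.sum_ite_mem, Finset.univ_inter, hφ, zero_mul]

/-- If `φ` has zero `q`-mean on `S`, then so has its average over the samples in `S`. -/
lemma iidExp_inv_nIn_mul_sum_eq_zero {S : Finset Ω} {q φ : Ω → ℝ} (hφ : ∑ s ∈ S, q s * φ s = 0)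
    (n : ℕ) :
    iidExp n q (fun v => (nIn S v : ℝ)⁻¹ *
      ∑ i ∈ Finset.univ.filter (fun i => v i ∈ S), φ (v i)) = 0 := by
  have key := Finset.sum_eq_zero fun (i : Fin n) (_ : i ∈ Finset.univ) =>
    iidExp_inv_nIn_mul_ite_eq_zero hφ i
  simp only [iidExp] at key ⊢
  rw [Finset.sum_comm] at key
  simpa only [← Finset.mul_sum, ← Finset.sum_filter] using key

/-- With positive weights, samples hit a nonempty set with positive probability. -/
lemma iidPr_nIn_pos {S : Finset Ω} (hS : S.Nonempty) {q : Ω → ℝ} (hq : ∀ s, 0 < q s)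
    {n : ℕ} (hn : 0 < n) : 0 < iidPr n q (fun v => 0 < nIn S v) := by
  obtain ⟨a, ha⟩ := hS
  have hprod (v : Fin n → Ω) : 0 < ∏ i, q (v i) := Finset.prod_pos fun i _ => hq (v i)
  refine Finset.sum_pos' (fun v _ => mul_nonneg (hprod v).le (by dsimp only; split_ifs <;> simp))
    ⟨fun _ => a, Finset.mem_univ _, ?_⟩
  have hpos : 0 < nIn S (fun _ : Fin n => a) := by simpa [nIn, ha] using hn
  simpa only [if_pos hpos, mul_one] using hprod fun _ => a

/-- **Conditional unbiasedness of k-DISCount with control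
variates.** For any `h : Ω → ℝ` with `H(T) = ∑_{s ∈ T} h s`, the control-variate
estimator `F̂_cv(S)` based on `n` i.i.d. samples from `ḡ_Ω` satisfies
`E[F̂_cv(S) | n(S) > 0] = F(S)`. -/
theorem kdiscount_cv_conditionally_unbiased
    (S : Finset Ω) (hS : S.Nonempty) (f h g : Ω → ℝ)
    (hf : ∀ s, 0 ≤ f s) (hg : ∀ s, 0 < g s)
    (n : ℕ) (hn : 0 < n) (q : Ω → ℝ) (hq : q = fun s => g s / ∑ t, g t) :
    iidExp n q (fun v => kdisCV S f h g v * if 0 < nIn S v then 1 else 0) /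
        iidPr n q (fun v => 0 < nIn S v)
      = ∑ s ∈ S, f s := by
  have hq_pos (s : Ω) : 0 < q s := by
    rw [hq]
    exact div_pos (hg s) (Finset.sum_pos (fun t _ => hg t) ⟨s, Finset.mem_univ s⟩)
  rw [div_eq_iff (iidPr_nIn_pos hS hq_pos hn).ne']
  let φ : Ω → ℝ := fun s =>
    (∑ t ∈ S, g t) * ((f s - h s) / g s) - (∑ t ∈ S, f t - ∑ t ∈ S, h t)
  have hφ : ∑ s ∈ S, q s * φ s = 0 := by
    have hterm (s : Ω) : q s * φ s = ((∑ t ∈ S, g t) * (f s - h s)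
        - g s * (∑ t ∈ S, f t - ∑ t ∈ S, h t)) / ∑ t, g t := by
      have hgs := (hg s).ne'
      simp only [hq, φ]
      field_simp
    rw [Finset.sum_congr rfl fun s _ => hterm s, ← Finset.sum_div, Finset.sum_sub_distrib,
      ← Finset.mul_sum, ← Finset.sum_mul, Finset.sum_sub_distrib, sub_self, zero_div]
  have hmean := iidExp_inv_nIn_mul_sum_eq_zero hφ n
  rw [← sub_eq_zero]
  refine Eq.trans ?_ hmean
  simp only [iidPr, iidExp, Finset.mul_sum (a := ∑ s ∈ S, f s), ← Finset.sum_sub_distrib]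
  refine Finset.sum_congr rfl fun v _ => ?_
  rw [mul_left_comm (∑ s ∈ S, f s), ← mul_sub]
  congr 1
  by_cases hv : 0 < nIn S v
  · have hne : (nIn S v : ℝ) ≠ 0 := by exact_mod_cast hv.ne'
    simp only [kdisCV, if_pos hv, φ, Finset.sum_sub_distrib _ _, ← Finset.mul_sum,
      Finset.sum_const, nsmul_eq_mul]
    rw [show (Finset.univ.filter fun i => v i ∈ S).card = nIn S v from rfl]
    field_simp
    ring
  · simp [kdisCV, Nat.eq_zero_of_not_pos hv]
end
end
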